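/- arXiv:1604.02080 — 7 statements merged into one kernel-verified Lean document; each statement's English description precedes it below -/
import Mathlib

section
/- For every probability mass function π on A, the bounded-rational objective ∑_a π(a)·r(a) − (1/α)·∑_a π(a)·log(π(a)/ρ(a)) is at most (1/α)·log(∑_a ρ(a)·exp(α·r(a))), and the supremum of this objective over all probability mass functions π on A equals (1/α)·log(∑_a ρ(a)·exp(α·r(a))). -/
/-- The pointwise form of Gibbs' inequality. -/
lemma sub_le_mul_log_div {p q : ℝ} (hp : 0 ≤ p) (hq : 0 < q) :
    p - q ≤ p * Real.log (p / q) := by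
  rcases hp.eq_or_lt with rfl | hp
  · simpa using hq.le
  · have h := mul_le_mul_of_nonneg_left (Real.one_sub_inv_le_log_of_pos (div_pos hp hq)) hp.le
    have e : p * (1 - (p / q)⁻¹) = p - q := by field_simp
    rwa [e] at h

/-- Gibbs' inequality: the relative entropy of two finite probability distributions is
nonnegative. -/
lemma sum_mul_log_div_nonneg {A : Type*} [Fintype A] {p q : A → ℝ}
    (hp : ∀ a, 0 ≤ p a) (hq : ∀ a, 0 < q a) (h : ∑ a, p a = ∑ a, q a) :
    0 ≤ ∑ a, p a * Real.log (p a / q a) :=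
  calc 0 = ∑ a, (p a - q a) := by rw [Finset.sum_sub_distrib, h, sub_self]
    _ ≤ _ := Finset.sum_le_sum fun a _ ↦ sub_le_mul_log_div (hp a) (hq a)

/-- The bounded-rational objective is the free energy minus the scaled relative entropy to the
Gibbs distribution `a ↦ ρ a * exp (α * r a) / Z`. -/
lemma objective_eq {A : Type*} [Fintype A] {ρ r p : A → ℝ} {α Z : ℝ}
    (hρ : ∀ a, 0 < ρ a) (hα : α ≠ 0) (hZ : 0 < Z) (hp : ∀ a, 0 ≤ p a) (hsum : ∑ a, p a = 1) :
    (∑ a, p a * r a) - (1/α) * ∑ a, p a * Real.log (p a / ρ a)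
      = (1/α) * Real.log Z
        - (1/α) * ∑ a, p a * Real.log (p a / (ρ a * Real.exp (α * r a) / Z)) := by
  have key (a : A) : p a * Real.log (p a / (ρ a * Real.exp (α * r a) / Z))
      = p a * Real.log (p a / ρ a) - α * (p a * r a) + p a * Real.log Z := by
    rcases (hp a).eq_or_lt with h | h
    · simp [← h]
    · have hρa := hρ a
      rw [Real.log_div h.ne' (by positivity), Real.log_div (by positivity) hZ.ne',
        Real.log_mul hρa.ne' (Real.exp_ne_zero _), Real.log_exp, Real.log_div h.ne' hρa.ne']
      ring
  simp only [key, Finset.sum_add_distrib, Finset.sum_sub_distrib, ← Finset.mul_sum,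
    ← Finset.sum_mul, hsum]
  field_simp
  ring

/-- For every probability mass function π on A, the bounded-rational objective
`∑ a, π a * r a - (1/α) * ∑ a, π a * log (π a / ρ a)` is at most
`(1/α) * log (∑ a, ρ a * exp (α * r a))`, and the supremum of this objective over all
probability mass functions π on A equals that value.
(The convention 0·log 0 = 0 holds automatically since `0 * x = 0` in ℝ.) -/
theorem stmt0 {A : Type*} [Fintype A] [Nonempty A]
    (ρ : A → ℝ) (hρpos : ∀ a, 0 < ρ a) (hρsum : ∑ a, ρ a = 1)
    (r : A → ℝ) (α : ℝ) (hα : 0 < α) :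
    (∀ π : A → ℝ, (∀ a, 0 ≤ π a) → ∑ a, π a = 1 →
      (∑ a, π a * r a) - (1/α) * ∑ a, π a * Real.log (π a / ρ a)
        ≤ (1/α) * Real.log (∑ a, ρ a * Real.exp (α * r a))) ∧
    IsLUB {x : ℝ | ∃ π : A → ℝ, (∀ a, 0 ≤ π a) ∧ (∑ a, π a = 1) ∧
        x = (∑ a, π a * r a) - (1/α) * ∑ a, π a * Real.log (π a / ρ a)}
      ((1/α) * Real.log (∑ a, ρ a * Real.exp (α * r a))) := by
  have hw (a : A) : 0 < ρ a * Real.exp (α * r a) := mul_pos (hρpos a) (Real.exp_pos _)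
  set Z := ∑ a, ρ a * Real.exp (α * r a) with hZdef
  have hZ : 0 < Z := Finset.sum_pos (fun a _ ↦ hw a) Finset.univ_nonempty
  have hg (a : A) : 0 < ρ a * Real.exp (α * r a) / Z := div_pos (hw a) hZ
  have hgsum : ∑ a, ρ a * Real.exp (α * r a) / Z = 1 := by
    rw [← Finset.sum_div, ← hZdef, div_self hZ.ne']
  have bound (p : A → ℝ) (hp : ∀ a, 0 ≤ p a) (hsum : ∑ a, p a = 1) :
      (∑ a, p a * r a) - (1/α) * ∑ a, p a * Real.log (p a / ρ a) ≤ (1/α) * Real.log Z := by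
    rw [objective_eq hρpos hα.ne' hZ hp hsum]
    exact sub_le_self _ (mul_nonneg (by positivity)
      (sum_mul_log_div_nonneg hp hg (hsum.trans hgsum.symm)))
  refine ⟨bound, IsGreatest.isLUB ⟨⟨_, fun a ↦ (hg a).le, hgsum, ?_⟩, ?_⟩⟩
  · rw [objective_eq hρpos hα.ne' hZ (fun a ↦ (hg a).le) hgsum]
    simp [div_self (hg _).ne']
  · rintro x ⟨p, hp, hsum, rfl⟩
    exact bound p hp hsum
end

section
/- The operator T has a unique fixed point: if F' : S → ℝ satisfies F' = g + γ · P.mulVec F', then F' = ∑_{t=0}^{∞} γ^t · (P^t).mulVec g. -/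
theorem Matrix.abs_mulVec_le_of_rowStochastic {S : Type*} [Fintype S] {P : Matrix S S ℝ}
    (hP0 : ∀ s s', 0 ≤ P s s') (hP1 : ∀ s, ∑ s', P s s' = 1) {v : S → ℝ} {C : ℝ}
    (hv : ∀ s, |v s| ≤ C) (s : S) : |(P.mulVec v) s| ≤ C :=
  calc |∑ s', P s s' * v s'| ≤ ∑ s', |P s s' * v s'| := Finset.abs_sum_le_sum_abs _ _
    _ ≤ ∑ s', P s s' * C := Finset.sum_le_sum fun s' _ => by
        rw [abs_mul, abs_of_nonneg (hP0 s s')]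
        exact mul_le_mul_of_nonneg_left (hv s') (hP0 s s')
    _ = C := by rw [← Finset.sum_mul, hP1, one_mul]

theorem Matrix.abs_pow_mulVec_le_of_rowStochastic {S : Type*} [Fintype S] [DecidableEq S]
    {P : Matrix S S ℝ} (hP0 : ∀ s s', 0 ≤ P s s') (hP1 : ∀ s, ∑ s', P s s' = 1)
    (v : S → ℝ) (n : ℕ) (s : S) : |((P ^ n).mulVec v) s| ≤ ‖v‖ := by
  induction n generalizing s with
  | zero => simpa using norm_le_pi_norm v s
  | succ n ih =>
    rw [pow_succ', ← Matrix.mulVec_mulVec]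
    exact Matrix.abs_mulVec_le_of_rowStochastic hP0 hP1 ih s

theorem Matrix.abs_discounted_pow_mulVec_le {S : Type*} [Fintype S] [DecidableEq S]
    {P : Matrix S S ℝ} (hP0 : ∀ s s', 0 ≤ P s s') (hP1 : ∀ s, ∑ s', P s s' = 1)
    {γ : ℝ} (hγ : 0 ≤ γ) (v : S → ℝ) (n : ℕ) (s : S) :
    ‖γ ^ n * ((P ^ n).mulVec v) s‖ ≤ γ ^ n * ‖v‖ := by
  rw [Real.norm_eq_abs, abs_mul, abs_of_nonneg (pow_nonneg hγ n)]
  exact mul_le_mul_of_nonneg_left (Matrix.abs_pow_mulVec_le_of_rowStochastic hP0 hP1 v n s)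
    (pow_nonneg hγ n)

theorem Matrix.affine_fixedPoint_eq_sum_add {S : Type*} [Fintype S] [DecidableEq S]
    {P : Matrix S S ℝ} {γ : ℝ} {g F : S → ℝ} (hF : F = g + γ • P.mulVec F) (n : ℕ) (s : S) :
    F s = ∑ t ∈ Finset.range n, γ ^ t * ((P ^ t).mulVec g) s + γ ^ n * ((P ^ n).mulVec F) s := by
  induction n with
  | zero => simp
  | succ n ih =>
    have h : ((P ^ n).mulVec F) s =
        ((P ^ n).mulVec g) s + γ * ((P ^ (n + 1)).mulVec F) s := by
      conv_lhs => rw [hF]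
      rw [Matrix.mulVec_add, Matrix.mulVec_smul, Matrix.mulVec_mulVec, ← pow_succ]
      rfl
    rw [Finset.sum_range_succ, ih, h]
    ring


/-- The affine operator `(T F) s = g s + γ * (P.mulVec F) s` has a unique
fixed point: if `F' = g + γ • P.mulVec F'` then `F' = fun s => ∑' t, γ^t * ((P^t).mulVec g) s`. -/
theorem stmt7 {S : Type*} [Fintype S] [Nonempty S] [DecidableEq S]
    (P : Matrix S S ℝ) (hP0 : ∀ s s', 0 ≤ P s s') (hP1 : ∀ s, ∑ s', P s s' = 1)
    (γ : ℝ) (hγ0 : 0 < γ) (hγ1 : γ < 1) (g : S → ℝ)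
    (F' : S → ℝ) (hF' : ∀ s, F' s = g s + γ * (P.mulVec F') s) :
    F' = fun s => ∑' t : ℕ, γ ^ t * ((P ^ t).mulVec g) s := by
  have hfix : F' = g + γ • P.mulVec F' := funext hF'
  have hgeom (v : S → ℝ) : Summable fun t : ℕ => γ ^ t * ‖v‖ :=
    (summable_geometric_of_lt_one hγ0.le hγ1).mul_right _
  have hsummable (v : S → ℝ) (s : S) : Summable fun t : ℕ => γ ^ t * ((P ^ t).mulVec v) s :=
    .of_norm_bounded (hgeom v) fun t => Matrix.abs_discounted_pow_mulVec_le hP0 hP1 hγ0.le v t s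
  funext s
  have hlim := (hsummable g s).hasSum.tendsto_sum_nat.add (hsummable F' s).tendsto_atTop_zero
  simp only [← Matrix.affine_fixedPoint_eq_sum_add hfix, add_zero] at hlim
  exact tendsto_nhds_unique tendsto_const_nhds hlim
end

section
/- Fix a bounded F : S → ℝ, a state s ∈ S, and β > 0. Then the supremum over probability mass functions π on A and over families ψ = (ψ_a)_{a∈A} of probability measures on Θ with ψ_a ≪ μ(·|a,s) and KL(ψ_a‖μ(·|a,s)) < ∞, of the quantity ∑_a π(a)·( −(1/α)·log(π(a)/ρ(a|s)) + ∫_Θ ( −(1/β)·log(dψ_a/dμ(·|a,s))(θ) + ∑_{s'} T_θ(s'|a,s)·(R(s,a,s') + γ·F(s')) ) dψ_a(θ) ), equals the closed-form value (1/α)·log ∑_a ρ(a|s)·( ∫_Θ exp( β·∑_{s'} T_θ(s'|a,s)·(R(s,a,s') + γ·F(s')) ) dμ(θ|a,s) )^{α/β}. -/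
open MeasureTheory

/-- The discrete Gibbs variational inequality: `∑ a, p a * (g a - log (p a / q a))` is at most the
log-partition function `log (∑ a, q a * exp (g a))`. -/
theorem sum_mul_sub_log_div_le {A : Type*} [Fintype A] [Nonempty A] (p q g : A → ℝ)
    (hp : ∀ a, 0 ≤ p a) (hp1 : ∑ a, p a = 1) (hq : ∀ a, 0 < q a) :
    ∑ a, p a * (g a - Real.log (p a / q a)) ≤ Real.log (∑ a, q a * Real.exp (g a)) := by
  set Z := ∑ a, q a * Real.exp (g a) with hZ
  have hZpos : 0 < Z :=
    Finset.sum_pos (fun a _ => mul_pos (hq a) (Real.exp_pos _)) Finset.univ_nonempty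
  have key : ∀ a, p a * (g a - Real.log (p a / q a)) - p a * Real.log Z
      ≤ q a * Real.exp (g a) / Z - p a := by
    intro a
    have hqa := hq a
    have hexp := Real.exp_pos (g a)
    rcases (hp a).eq_or_lt with h | h
    · rw [← h]
      simp only [zero_mul, sub_zero]
      positivity
    · have hlog : Real.log (q a * Real.exp (g a) / (Z * p a))
          = g a - Real.log (p a / q a) - Real.log Z := by
        rw [Real.log_div (by positivity) (by positivity), Real.log_mul hqa.ne' hexp.ne',
          Real.log_exp, Real.log_mul hZpos.ne' h.ne', Real.log_div h.ne' hqa.ne']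
        ring
      have hle := mul_le_mul_of_nonneg_left
        (Real.log_le_sub_one_of_pos (x := q a * Real.exp (g a) / (Z * p a)) (by positivity)) h.le
      rw [hlog] at hle
      have heq : p a * (q a * Real.exp (g a) / (Z * p a) - 1) = q a * Real.exp (g a) / Z - p a := by
        field_simp
      linarith
  have hsum := Finset.sum_le_sum fun a (_ : a ∈ Finset.univ) => key a
  rw [Finset.sum_sub_distrib, Finset.sum_sub_distrib, ← Finset.sum_mul, ← Finset.sum_div, hp1,
    ← hZ, div_self hZpos.ne'] at hsum
  linarith

/-- The Gibbs (Donsker–Varadhan) variational inequality. -/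
theorem integral_sub_integral_llr_le_log_integral_exp {Θ : Type*} [MeasurableSpace Θ]
    (ψ μ : Measure Θ) [IsProbabilityMeasure ψ] [IsProbabilityMeasure μ] (hac : ψ ≪ μ)
    (hint : Integrable (llr ψ μ) ψ) {f : Θ → ℝ} (hfψ : Integrable f ψ)
    (hfμ : Integrable (fun θ => Real.exp (f θ)) μ) :
    ∫ θ, f θ ∂ψ - ∫ θ, llr ψ μ θ ∂ψ ≤ Real.log (∫ θ, Real.exp (f θ) ∂μ) := by
  have := isProbabilityMeasure_tilted hfμ
  have heq := integral_llr_tilted_right hac hfψ hfμ hint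
  have hnn := InformationTheory.integral_llr_add_sub_measure_univ_nonneg
    (hac.trans (absolutelyContinuous_tilted hfμ))
    (integrable_llr_tilted_right hac hfψ hint hfμ)
  simp only [probReal_univ] at hnn
  linarith

/-- The tilted measure attains equality in the Gibbs variational inequality: its log-likelihood
ratio is `f` minus the log-partition function, almost everywhere. -/
theorem llr_tilted_self_ae {Θ : Type*} [MeasurableSpace Θ] (μ : Measure Θ) [SigmaFinite μ]
    {f : Θ → ℝ} (hf : Integrable (fun θ => Real.exp (f θ)) μ) :
    (fun θ => Real.log (((μ.tilted f).rnDeriv μ θ).toReal))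
      =ᵐ[μ.tilted f] fun θ => f θ - Real.log (∫ θ, Real.exp (f θ) ∂μ) :=
  (tilted_absolutelyContinuous μ f).ae_le (log_rnDeriv_tilted_left_self hf)

/-- For fixed bounded F, state s and β > 0, the supremum over probability mass
functions π on A and families ψ of probability measures on Θ (with ψ a ≪ μ a s and finite KL)
of
`∑ a, π a * ( -(1/α)·log (π a / ρ s a)
    + ∫ ( -(1/β)·log (d(ψ a)/d(μ a s)) θ + ∑ s', Tθ θ a s' * (R s a s' + γ * F s') ) d(ψ a) )`
equals the closed-form value
`(1/α) * log ∑ a, ρ s a * (∫ exp (β * ∑ s', Tθ θ a s' * (R s a s' + γ * F s')) d(μ a s)) ^ (α/β)`. -/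
theorem stmt9 {S A : Type*} [Fintype S] [Nonempty S] [Fintype A] [Nonempty A]
    {Θ : Type*} [MeasurableSpace Θ]
    (ρ : S → A → ℝ) (hρpos : ∀ s a, 0 < ρ s a) (hρsum : ∀ s, ∑ a, ρ s a = 1)
    (μ : A → S → Measure Θ) (hμ : ∀ a s, IsProbabilityMeasure (μ a s))
    (Tθ : Θ → A → S → S → ℝ)
    (hT0 : ∀ θ a s s', 0 ≤ Tθ θ a s s') (hT1 : ∀ θ a s, ∑ s', Tθ θ a s s' = 1)
    (hTmeas : ∀ a s s', Measurable (fun θ => Tθ θ a s s'))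
    (R : S → A → S → ℝ) (CR : ℝ) (hR : ∀ s a s', |R s a s'| ≤ CR)
    (α : ℝ) (hα : 0 < α) (β : ℝ) (hβ : 0 < β)
    (γ : ℝ) (hγ0 : 0 < γ) (hγ1 : γ < 1)
    (F : S → ℝ) (CF : ℝ) (hF : ∀ s, |F s| ≤ CF) (s : S) :
    IsLUB {x : ℝ | ∃ (π : A → ℝ) (ψ : A → Measure Θ),
        (∀ a, 0 ≤ π a) ∧ (∑ a, π a = 1) ∧
        (∀ a, IsProbabilityMeasure (ψ a)) ∧ (∀ a, ψ a ≪ μ a s) ∧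
        (∀ a, Integrable (fun θ => Real.log (((ψ a).rnDeriv (μ a s) θ).toReal)) (ψ a)) ∧
        x = ∑ a, π a * ( -(1/α) * Real.log (π a / ρ s a)
              + ∫ θ, ( -(1/β) * Real.log (((ψ a).rnDeriv (μ a s) θ).toReal)
                  + ∑ s', Tθ θ a s s' * (R s a s' + γ * F s') ) ∂(ψ a) )}
      ((1/α) * Real.log (∑ a, ρ s a *
        (∫ θ, Real.exp (β * ∑ s', Tθ θ a s s' * (R s a s' + γ * F s')) ∂(μ a s)) ^ (α/β))) := by
  have := fun a => hμ a s
  set f : A → Θ → ℝ := fun a θ => ∑ s', Tθ θ a s s' * (R s a s' + γ * F s') with hf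
  have hfm : ∀ a, Measurable (f a) := fun a =>
    Finset.measurable_sum _ fun s' _ => (hTmeas a s s').mul_const _
  have hfb : ∀ a θ, |f a θ| ≤ ∑ s', |R s a s' + γ * F s'| := by
    intro a θ
    refine (Finset.abs_sum_le_sum_abs _ _).trans (Finset.sum_le_sum fun s' _ => ?_)
    rw [abs_mul, abs_of_nonneg (hT0 θ a s s')]
    refine mul_le_of_le_one_left (abs_nonneg _) ?_
    rw [← hT1 θ a s]
    exact Finset.single_le_sum (fun i _ => hT0 θ a s i) (Finset.mem_univ s')
  have hfint : ∀ a (ν : Measure Θ) [IsProbabilityMeasure ν], Integrable (f a) ν := fun a ν _ =>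
    Integrable.of_bound (hfm a).aestronglyMeasurable _ (ae_of_all _ (hfb a))
  have hexpint : ∀ a, Integrable (fun θ => Real.exp (β * f a θ)) (μ a s) := fun a =>
    Integrable.of_bound (C := Real.exp (β * ∑ s', |R s a s' + γ * F s'|))
      ((hfm a).const_mul β).exp.aestronglyMeasurable (ae_of_all _ fun θ => by
        rw [Real.norm_eq_abs, Real.abs_exp]
        gcongr
        exact (le_abs_self _).trans (hfb a θ))
  set Z : A → ℝ := fun a => ∫ θ, Real.exp (β * f a θ) ∂(μ a s) with hZ
  have hZpos : ∀ a, 0 < Z a := fun a => integral_exp_pos (hexpint a)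
  have hZexp : ∀ a, Z a ^ (α / β) = Real.exp (α / β * Real.log (Z a)) := fun a => by
    rw [Real.rpow_def_of_pos (hZpos a), mul_comm]
  have hWpos : 0 < ∑ a, ρ s a * Z a ^ (α / β) :=
    Finset.sum_pos (fun a _ => mul_pos (hρpos s a) (Real.rpow_pos_of_pos (hZpos a) _))
      Finset.univ_nonempty
  refine IsGreatest.isLUB ⟨?_, ?_⟩
  · set W := ∑ a, ρ s a * Z a ^ (α / β) with hW
    have hprob : ∀ a, IsProbabilityMeasure ((μ a s).tilted fun θ => β * f a θ) := fun a =>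
      isProbabilityMeasure_tilted (hexpint a)
    have hsum1 : ∑ a, ρ s a * Z a ^ (α / β) / W = 1 := by
      rw [← Finset.sum_div, ← hW, div_self hWpos.ne']
    refine ⟨fun a => ρ s a * Z a ^ (α / β) / W, fun a => (μ a s).tilted fun θ => β * f a θ,
      fun a => div_nonneg (mul_nonneg (hρpos s a).le (Real.rpow_nonneg (hZpos a).le _)) hWpos.le,
      hsum1, hprob, fun a => tilted_absolutelyContinuous _ _, fun a => ?_, ?_⟩
    · refine Integrable.congr ?_ (llr_tilted_self_ae _ (hexpint a)).symm
      exact ((hfint a _).const_mul β).sub (integrable_const _)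
    · have hterm : ∀ a, -(1 / α) * Real.log (ρ s a * Z a ^ (α / β) / W / ρ s a)
          + ∫ θ, (-(1 / β) * Real.log
              ((((μ a s).tilted fun θ => β * f a θ).rnDeriv (μ a s) θ).toReal) + f a θ)
            ∂((μ a s).tilted fun θ => β * f a θ) = 1 / α * Real.log W := by
        intro a
        have hI : ∫ θ, (-(1 / β) * Real.log
              ((((μ a s).tilted fun θ => β * f a θ).rnDeriv (μ a s) θ).toReal) + f a θ)
            ∂((μ a s).tilted fun θ => β * f a θ) = 1 / β * Real.log (Z a) := by
          have hae : (fun θ => -(1 / β) * Real.log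
              ((((μ a s).tilted fun θ => β * f a θ).rnDeriv (μ a s) θ).toReal) + f a θ)
              =ᵐ[(μ a s).tilted fun θ => β * f a θ] fun _ => 1 / β * Real.log (Z a) := by
            filter_upwards [llr_tilted_self_ae _ (hexpint a)] with θ hθ
            rw [hθ]
            field_simp
            ring
          have := hprob a
          rw [integral_congr_ae hae, integral_const]
          simp
        have hρa := hρpos s a
        have hquot : ρ s a * Z a ^ (α / β) / W / ρ s a = Z a ^ (α / β) / W := by field_simp
        rw [hI, hquot, Real.log_div (Real.rpow_pos_of_pos (hZpos a) _).ne' hWpos.ne',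
          Real.log_rpow (hZpos a)]
        field_simp
        ring
      refine Eq.symm ((Finset.sum_congr rfl fun a _ => congrArg _ (hterm a)).trans ?_)
      rw [← Finset.sum_mul, hsum1, one_mul]
  · rintro x ⟨π, ψ, hπ, hπ1, hψ, hac, hllr, rfl⟩
    have hgibbs := sum_mul_sub_log_div_le π (ρ s) (fun a => α / β * Real.log (Z a)) hπ hπ1 (hρpos s)
    simp only [← hZexp] at hgibbs
    refine le_trans ?_ (mul_le_mul_of_nonneg_left hgibbs (one_div_pos.2 hα).le)
    rw [Finset.mul_sum]
    refine Finset.sum_le_sum fun a _ => ?_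
    have := hψ a
    have hDV := integral_sub_integral_llr_le_log_integral_exp (ψ a) (μ a s) (hac a) (hllr a)
      ((hfint a (ψ a)).const_mul β) (hexpint a)
    have hI : ∫ θ, (-(1 / β) * Real.log (((ψ a).rnDeriv (μ a s) θ).toReal) + f a θ) ∂(ψ a)
        = 1 / β * (∫ θ, β * f a θ ∂(ψ a) - ∫ θ, llr (ψ a) (μ a s) θ ∂(ψ a)) := by
      rw [integral_add ((hllr a).const_mul _) (hfint a _), integral_const_mul, integral_const_mul,
        llr_def]
      field_simp
      ring
    have hle := mul_le_mul_of_nonneg_left hDV (one_div_pos.2 hβ).le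
    rw [← hI] at hle
    have hrw : 1 / α * (π a * (α / β * Real.log (Z a) - Real.log (π a / ρ s a)))
        = π a * (-(1 / α) * Real.log (π a / ρ s a) + 1 / β * Real.log (Z a)) := by
      field_simp
      ring
    rw [hrw]
    exact mul_le_mul_of_nonneg_left (by linarith) (hπ a)
end

section
/- Fix a bounded F : S → ℝ, a state s ∈ S, and β < 0. Then the supremum over probability mass functions π on A of the infimum over families ψ = (ψ_a)_{a∈A} of probability measures on Θ with ψ_a ≪ μ(·|a,s) and KL(ψ_a‖μ(·|a,s)) < ∞, of the quantity ∑_a π(a)·( −(1/α)·log(π(a)/ρ(a|s)) + ∫_Θ ( −(1/β)·log(dψ_a/dμ(·|a,s))(θ) + ∑_{s'} T_θ(s'|a,s)·(R(s,a,s') + γ·F(s')) ) dψ_a(θ) ), equals the closed-form value (1/α)·log ∑_a ρ(a|s)·( ∫_Θ exp( β·∑_{s'} T_θ(s'|a,s)·(R(s,a,s') + γ·F(s')) ) dμ(θ|a,s) )^{α/β}. -/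
open MeasureTheory

/-- The exponential of a multiple of a bounded measurable function is integrable. -/
lemma integrable_exp_const_mul_of_bounded {Θ : Type*} [MeasurableSpace Θ] (μ : Measure Θ)
    [IsFiniteMeasure μ] {f : Θ → ℝ} (hf : Measurable f) {C : ℝ} (hC : ∀ θ, |f θ| ≤ C) (β : ℝ) :
    Integrable (fun θ => Real.exp (β * f θ)) μ := by
  refine .of_bound (hf.const_mul β).exp.aestronglyMeasurable (Real.exp (|β| * C))
    (.of_forall fun θ => ?_)
  rw [Real.norm_eq_abs, Real.abs_exp, Real.exp_le_exp]
  calc β * f θ ≤ |β * f θ| := le_abs_self _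
    _ = |β| * |f θ| := abs_mul _ _
    _ ≤ |β| * C := by gcongr; exact hC θ

/-- Gibbs variational inequality: for `β < 0`, the penalised expectation of `f` under `ψ` is at
least the certainty equivalent of `f` under `μ`. -/
lemma certaintyEquivalent_le_integral {Θ : Type*} [MeasurableSpace Θ] (μ ψ : Measure Θ)
    [IsProbabilityMeasure μ] [IsProbabilityMeasure ψ] {f : Θ → ℝ} {β : ℝ} (hβ : β < 0)
    (hψμ : ψ ≪ μ) (hllr : Integrable (llr ψ μ) ψ) (hfψ : Integrable f ψ)
    (hexp : Integrable (fun θ => Real.exp (β * f θ)) μ) :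
    1 / β * Real.log (∫ θ, Real.exp (β * f θ) ∂μ)
      ≤ ∫ θ, (-(1 / β) * Real.log ((ψ.rnDeriv μ θ).toReal) + f θ) ∂ψ := by
  have hβf : Integrable (fun θ => β * f θ) ψ := hfψ.const_mul β
  have : IsProbabilityMeasure (μ.tilted fun θ => β * f θ) := isProbabilityMeasure_tilted hexp
  have hgibbs := InformationTheory.integral_llr_add_sub_measure_univ_nonneg
    (hψμ.trans (absolutelyContinuous_tilted hexp))
    (integrable_llr_tilted_right hψμ hβf hllr hexp)
  rw [integral_llr_tilted_right hψμ hβf hexp hllr] at hgibbs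
  simp only [probReal_univ, integral_const_mul] at hgibbs
  have hsplit : ∫ θ, (-(1 / β) * Real.log ((ψ.rnDeriv μ θ).toReal) + f θ) ∂ψ
      = -(1 / β) * ∫ θ, llr ψ μ θ ∂ψ + ∫ θ, f θ ∂ψ := by
    rw [← integral_const_mul]
    exact integral_add (hllr.const_mul _) hfψ
  have hdiff : (-(1 / β) * ∫ θ, llr ψ μ θ ∂ψ + ∫ θ, f θ ∂ψ)
      - 1 / β * Real.log (∫ θ, Real.exp (β * f θ) ∂μ)
      = -(1 / β) * (∫ θ, llr ψ μ θ ∂ψ - β * ∫ θ, f θ ∂ψ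
        + Real.log (∫ θ, Real.exp (β * f θ) ∂μ)) := by
    field_simp [hβ.ne]
    ring
  rw [hsplit, ← sub_nonneg, hdiff]
  refine mul_nonneg ?_ (by linarith)
  rw [neg_nonneg]
  exact one_div_nonpos.mpr hβ.le

/-- The log-likelihood ratio of an exponentially tilted measure is almost everywhere affine in
the tilting function. -/
lemma log_rnDeriv_tilted_ae_tilted {Θ : Type*} [MeasurableSpace Θ] (μ : Measure Θ)
    [SigmaFinite μ] {g : Θ → ℝ} (hexp : Integrable (fun θ => Real.exp (g θ)) μ) :
    (fun θ => Real.log (((μ.tilted g).rnDeriv μ θ).toReal))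
      =ᵐ[μ.tilted g] fun θ => g θ - Real.log (∫ x, Real.exp (g x) ∂μ) :=
  (tilted_absolutelyContinuous μ g).ae_le (log_rnDeriv_tilted_left_self hexp)

/-- The exponentially tilted measure attains the Gibbs variational bound. -/
lemma integral_tilted_eq_certaintyEquivalent {Θ : Type*} [MeasurableSpace Θ] (μ : Measure Θ)
    [IsProbabilityMeasure μ] {f : Θ → ℝ} {β : ℝ} (hβ : β ≠ 0)
    (hexp : Integrable (fun θ => Real.exp (β * f θ)) μ) :
    ∫ θ, (-(1 / β) * Real.log (((μ.tilted fun x => β * f x).rnDeriv μ θ).toReal) + f θ)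
        ∂(μ.tilted fun x => β * f x)
      = 1 / β * Real.log (∫ θ, Real.exp (β * f θ) ∂μ) := by
  have : IsProbabilityMeasure (μ.tilted fun θ => β * f θ) := isProbabilityMeasure_tilted hexp
  have hconst : (fun θ => -(1 / β) *
        Real.log (((μ.tilted fun x => β * f x).rnDeriv μ θ).toReal) + f θ)
      =ᵐ[μ.tilted fun x => β * f x]
        fun _ => 1 / β * Real.log (∫ θ, Real.exp (β * f θ) ∂μ) := by
    filter_upwards [log_rnDeriv_tilted_ae_tilted μ hexp] with θ hθ
    rw [hθ]
    field_simp
    ring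
  rw [integral_congr_ae hconst]
  simp

/-- The robust value of a family of functions `f a` under fixed weights `π`, with the
adversary penalised by relative entropy. -/
lemma isLeast_penalised_integral {A Θ : Type*} [Fintype A] [MeasurableSpace Θ]
    (μ : A → Measure Θ) (hμ : ∀ a, IsProbabilityMeasure (μ a)) {f : A → Θ → ℝ}
    (hf : ∀ a, Measurable (f a)) {C : ℝ} (hC : ∀ a θ, |f a θ| ≤ C) {β : ℝ} (hβ : β < 0)
    {π : A → ℝ} (hπ : ∀ a, 0 ≤ π a) (c : A → ℝ) :
    IsLeast {y : ℝ | ∃ ψ : A → Measure Θ,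
          (∀ a, IsProbabilityMeasure (ψ a)) ∧ (∀ a, ψ a ≪ μ a) ∧
          (∀ a, Integrable (fun θ => Real.log (((ψ a).rnDeriv (μ a) θ).toReal)) (ψ a)) ∧
          y = ∑ a, π a * (c a
                + ∫ θ, (-(1 / β) * Real.log (((ψ a).rnDeriv (μ a) θ).toReal) + f a θ) ∂(ψ a))}
      (∑ a, π a * (c a + 1 / β * Real.log (∫ θ, Real.exp (β * f a θ) ∂(μ a)))) := by
  have hfint (a : A) (ν : Measure Θ) [IsProbabilityMeasure ν] : Integrable (f a) ν :=
    .of_bound (hf a).aestronglyMeasurable C (.of_forall (hC a))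
  have hexp (a : A) : Integrable (fun θ => Real.exp (β * f a θ)) (μ a) :=
    integrable_exp_const_mul_of_bounded (μ a) (hf a) (hC a) β
  constructor
  · have hprob (a : A) : IsProbabilityMeasure ((μ a).tilted fun θ => β * f a θ) :=
      isProbabilityMeasure_tilted (hexp a)
    refine ⟨fun a => (μ a).tilted fun θ => β * f a θ, hprob,
      fun a => tilted_absolutelyContinuous _ _, fun a => ?_, ?_⟩
    · rw [integrable_congr (log_rnDeriv_tilted_ae_tilted (μ a) (hexp a))]
      exact ((hfint a _).const_mul β).sub (integrable_const _)
    · exact Finset.sum_congr rfl fun a _ => by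
        rw [integral_tilted_eq_certaintyEquivalent (μ a) hβ.ne (hexp a)]
  · rintro y ⟨ψ, hψ, hac, hllr, rfl⟩
    gcongr with a
    · exact hπ a
    · exact certaintyEquivalent_le_integral (μ a) (ψ a) hβ (hac a) (hllr a) (hfint a _) (hexp a)

/-- Finite Gibbs variational principle: entropy-regularised maximisation over the simplex is a
log-sum-exp. -/
lemma isGreatest_entropy_regularised {A : Type*} [Fintype A] [Nonempty A] {ρ : A → ℝ}
    (hρ : ∀ a, 0 < ρ a) (m : A → ℝ) {α : ℝ} (hα : 0 < α) :
    IsGreatest {x : ℝ | ∃ π : A → ℝ, (∀ a, 0 ≤ π a) ∧ (∑ a, π a = 1) ∧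
        x = ∑ a, π a * (-(1 / α) * Real.log (π a / ρ a) + m a)}
      (1 / α * Real.log (∑ a, ρ a * Real.exp (α * m a))) := by
  set W := ∑ a, ρ a * Real.exp (α * m a) with hW
  have hw (a : A) : 0 < ρ a * Real.exp (α * m a) := mul_pos (hρ a) (Real.exp_pos _)
  have hWpos : 0 < W := Finset.sum_pos (fun a _ => hw a) Finset.univ_nonempty
  constructor
  · have hsum : ∑ a, ρ a * Real.exp (α * m a) / W = 1 := by
      rw [← Finset.sum_div, ← hW, div_self hWpos.ne']
    refine ⟨fun a => ρ a * Real.exp (α * m a) / W, fun a => (div_pos (hw a) hWpos).le, hsum, ?_⟩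
    have hterm (a : A) : -(1 / α) * Real.log (ρ a * Real.exp (α * m a) / W / ρ a) + m a
        = 1 / α * Real.log W := by
      have hcancel : ρ a * Real.exp (α * m a) / W / ρ a = Real.exp (α * m a) / W := by
        field_simp [(hρ a).ne']
      rw [hcancel, Real.log_div (Real.exp_ne_zero _) hWpos.ne', Real.log_exp]
      field_simp
      ring
    simp_rw [hterm]
    rw [← Finset.sum_mul, hsum, one_mul]
  · rintro x ⟨π, hπ, hsum, rfl⟩
    have hterm (a : A) : π a * (-(1 / α) * Real.log (π a / ρ a) + m a)
        ≤ π a * (1 / α * Real.log W) + 1 / α * (ρ a * Real.exp (α * m a) / W - π a) := by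
      rcases (hπ a).eq_or_lt with h0 | hpos
      · rw [← h0]
        have := div_pos (hw a) hWpos
        simp only [zero_mul, zero_add, sub_zero]
        positivity
      · have hlog := Real.log_le_sub_one_of_pos
          (div_pos (div_pos (hw a) hWpos) hpos)
        rw [Real.log_div (div_pos (hw a) hWpos).ne' hpos.ne',
          Real.log_div (hw a).ne' hWpos.ne', Real.log_mul (hρ a).ne' (Real.exp_ne_zero _),
          Real.log_exp] at hlog
        rw [Real.log_div hpos.ne' (hρ a).ne']
        have hmul := mul_le_mul_of_nonneg_left hlog (mul_nonneg (one_div_pos.mpr hα).le hpos.le)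
        have hright : 1 / α * π a * (ρ a * Real.exp (α * m a) / W / π a - 1)
            = 1 / α * (ρ a * Real.exp (α * m a) / W - π a) := by
          field_simp
        have hleft : 1 / α * π a * (Real.log (ρ a) + α * m a - Real.log W - Real.log (π a))
            = π a * (-(1 / α) * (Real.log (π a) - Real.log (ρ a)) + m a)
              - π a * (1 / α * Real.log W) := by
          field_simp
          ring
        linarith
    calc _ ≤ ∑ a, (π a * (1 / α * Real.log W)
          + 1 / α * (ρ a * Real.exp (α * m a) / W - π a)) := Finset.sum_le_sum fun a _ => hterm a
      _ = 1 / α * Real.log W := by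
        rw [Finset.sum_add_distrib, ← Finset.sum_mul, ← Finset.mul_sum, Finset.sum_sub_distrib,
          ← Finset.sum_div, ← hW, hsum, div_self hWpos.ne']
        ring

/-- For fixed bounded F, state s and β < 0, the supremum over probability mass
functions π on A of the infimum over families ψ of probability measures on Θ (with
ψ a ≪ μ a s and finite KL) of
`∑ a, π a * ( -(1/α)·log (π a / ρ s a)
    + ∫ ( -(1/β)·log (d(ψ a)/d(μ a s)) θ + ∑ s', Tθ θ a s' * (R s a s' + γ * F s') ) d(ψ a) )`
equals the closed-form value
`(1/α) * log ∑ a, ρ s a * (∫ exp (β * ∑ s', Tθ θ a s' * (R s a s' + γ * F s')) d(μ a s)) ^ (α/β)`. -/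
theorem stmt10 {S A : Type*} [Fintype S] [Nonempty S] [Fintype A] [Nonempty A]
    {Θ : Type*} [MeasurableSpace Θ]
    (ρ : S → A → ℝ) (hρpos : ∀ s a, 0 < ρ s a) (hρsum : ∀ s, ∑ a, ρ s a = 1)
    (μ : A → S → Measure Θ) (hμ : ∀ a s, IsProbabilityMeasure (μ a s))
    (Tθ : Θ → A → S → S → ℝ)
    (hT0 : ∀ θ a s s', 0 ≤ Tθ θ a s s') (hT1 : ∀ θ a s, ∑ s', Tθ θ a s s' = 1)
    (hTmeas : ∀ a s s', Measurable (fun θ => Tθ θ a s s'))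
    (R : S → A → S → ℝ) (CR : ℝ) (hR : ∀ s a s', |R s a s'| ≤ CR)
    (α : ℝ) (hα : 0 < α) (β : ℝ) (hβ : β < 0)
    (γ : ℝ) (hγ0 : 0 < γ) (hγ1 : γ < 1)
    (F : S → ℝ) (CF : ℝ) (hF : ∀ s, |F s| ≤ CF) (s : S) :
    IsLUB {x : ℝ | ∃ π : A → ℝ, (∀ a, 0 ≤ π a) ∧ (∑ a, π a = 1) ∧
        x = sInf {y : ℝ | ∃ ψ : A → Measure Θ,
          (∀ a, IsProbabilityMeasure (ψ a)) ∧ (∀ a, ψ a ≪ μ a s) ∧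
          (∀ a, Integrable (fun θ => Real.log (((ψ a).rnDeriv (μ a s) θ).toReal)) (ψ a)) ∧
          y = ∑ a, π a * ( -(1/α) * Real.log (π a / ρ s a)
                + ∫ θ, ( -(1/β) * Real.log (((ψ a).rnDeriv (μ a s) θ).toReal)
                    + ∑ s', Tθ θ a s s' * (R s a s' + γ * F s') ) ∂(ψ a) )}}
      ((1/α) * Real.log (∑ a, ρ s a *
        (∫ θ, Real.exp (β * ∑ s', Tθ θ a s s' * (R s a s' + γ * F s')) ∂(μ a s)) ^ (α/β))) := by
  set f : A → Θ → ℝ := fun a θ => ∑ s', Tθ θ a s s' * (R s a s' + γ * F s')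
  have hf (a : A) : Measurable (f a) :=
    Finset.measurable_fun_sum _ fun s' _ => (hTmeas a s s').mul_const _
  have hC (a : A) (θ : Θ) : |f a θ| ≤ CR + γ * CF := by
    calc |f a θ| ≤ ∑ s', |Tθ θ a s s' * (R s a s' + γ * F s')| := Finset.abs_sum_le_sum_abs _ _
      _ ≤ ∑ s', Tθ θ a s s' * (CR + γ * CF) := by
        refine Finset.sum_le_sum fun s' _ => ?_
        rw [abs_mul, abs_of_nonneg (hT0 θ a s s')]
        refine mul_le_mul_of_nonneg_left ((abs_add_le _ _).trans ?_) (hT0 θ a s s')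
        rw [abs_mul, abs_of_pos hγ0]
        exact add_le_add (hR s a s') (mul_le_mul_of_nonneg_left (hF s') hγ0.le)
      _ = CR + γ * CF := by rw [← Finset.sum_mul, hT1, one_mul]
  have hpow (a : A) : (∫ θ, Real.exp (β * f a θ) ∂(μ a s)) ^ (α / β)
      = Real.exp (α * (1 / β * Real.log (∫ θ, Real.exp (β * f a θ) ∂(μ a s)))) := by
    have := hμ a s
    have hpos : 0 < ∫ θ, Real.exp (β * f a θ) ∂(μ a s) :=
      integral_exp_pos (integrable_exp_const_mul_of_bounded (μ a s) (hf a) (hC a) β)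
    rw [Real.rpow_def_of_pos hpos]
    congr 1
    ring
  have hmax := isGreatest_entropy_regularised (hρpos s)
    (fun a => 1 / β * Real.log (∫ θ, Real.exp (β * f a θ) ∂(μ a s))) hα
  simp_rw [← hpow] at hmax
  refine (congrArg (IsLUB · _) (Set.ext fun x => ?_)).mpr hmax.isLUB
  refine exists_congr fun π => and_congr_right fun hπ => and_congr_right fun _ => ?_
  rw [(isLeast_penalised_integral (fun a => μ a s) (fun a => hμ a s) hf hC hβ hπ
    fun a => -(1 / α) * Real.log (π a / ρ s a)).csInf_eq]
end

section
/- The operator B is a γ-contraction in the supremum norm: for all bounded F, G : S → ℝ, sup_{s∈S} |(B F)(s) − (B G)(s)| ≤ γ · sup_{s∈S} |F(s) − G(s)|. -/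
open MeasureTheory

/-- An average of a function with respect to weights summing to one is bounded by any bound for
the function. -/
lemma abs_sum_mul_le_of_sum_eq_one {ι : Type*} [Fintype ι] {w x : ι → ℝ} {c : ℝ}
    (hw : ∀ i, 0 ≤ w i) (hw1 : ∑ i, w i = 1) (hx : ∀ i, |x i| ≤ c) :
    |∑ i, w i * x i| ≤ c := by
  calc |∑ i, w i * x i| ≤ ∑ i, |w i * x i| := Finset.abs_sum_le_sum_abs _ _
    _ ≤ ∑ i, w i * c := by
        refine Finset.sum_le_sum fun i _ => ?_
        rw [abs_mul, abs_of_nonneg (hw i)]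
        exact mul_le_mul_of_nonneg_left (hx i) (hw i)
    _ = c := by rw [← Finset.sum_mul, hw1, one_mul]

/-- The exponential of a bounded measurable function is integrable for a finite measure. -/
lemma integrable_exp_mul_of_abs_le {Ω : Type*} [MeasurableSpace Ω] {ν : Measure Ω}
    [IsFiniteMeasure ν] {h : Ω → ℝ} (hm : Measurable h) {C : ℝ} (hC : ∀ x, |h x| ≤ C) (β : ℝ) :
    Integrable (fun x => Real.exp (β * h x)) ν := by
  refine Integrable.of_bound (by fun_prop) (Real.exp (|β| * C)) (.of_forall fun x => ?_)
  rw [Real.norm_eq_abs, Real.abs_exp, Real.exp_le_exp]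
  calc β * h x ≤ |β * h x| := le_abs_self _
    _ = |β| * |h x| := abs_mul _ _
    _ ≤ |β| * C := mul_le_mul_of_nonneg_left (hC x) (abs_nonneg β)

/-- Raising the exponent function by at most `c` changes the power `α / β` of the exponential
moment of order `β` by a factor of at most `exp (α * c)`, whatever the sign of `β`. -/
lemma integral_exp_rpow_le {Ω : Type*} [MeasurableSpace Ω] {ν : Measure Ω} [NeZero ν]
    {h k : Ω → ℝ} {α β c : ℝ} (hα : 0 < α) (hβ : β ≠ 0)
    (hh : Integrable (fun x => Real.exp (β * h x)) ν)
    (hk : Integrable (fun x => Real.exp (β * k x)) ν) (hc : ∀ x, h x ≤ k x + c) :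
    (∫ x, Real.exp (β * h x) ∂ν) ^ (α / β) ≤
      Real.exp (α * c) * (∫ x, Real.exp (β * k x) ∂ν) ^ (α / β) := by
  have hhpos := integral_exp_pos hh
  have hkpos := integral_exp_pos hk
  have key : Real.exp (α * c) * (∫ x, Real.exp (β * k x) ∂ν) ^ (α / β) =
      (∫ x, Real.exp (β * (k x + c)) ∂ν) ^ (α / β) := by
    simp_rw [mul_add, Real.exp_add]
    rw [integral_mul_const, Real.mul_rpow hkpos.le (Real.exp_pos _).le, ← Real.exp_mul, mul_comm]
    congr 2
    field_simp
  have hkc : Integrable (fun x => Real.exp (β * (k x + c))) ν := by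
    simp_rw [mul_add, Real.exp_add]
    exact hk.mul_const _
  rw [key]
  rcases hβ.lt_or_gt with hneg | hpos
  · refine Real.rpow_le_rpow_of_nonpos (integral_exp_pos hkc) (integral_mono hkc hh fun x => ?_)
      (div_nonpos_of_nonneg_of_nonpos hα.le hneg.le)
    exact Real.exp_le_exp.2 (mul_le_mul_of_nonpos_left (hc x) hneg.le)
  · refine Real.rpow_le_rpow hhpos.le (integral_mono hh hkc fun x => ?_) (by positivity)
    exact Real.exp_le_exp.2 (mul_le_mul_of_nonneg_left (hc x) hpos.le)

/-- If `p a ≤ exp (α * c) * q a` for all `a`, then the normalized logarithms of the weighted sums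
of `p` and `q` differ by at most `c`. -/
lemma log_sum_mul_le_add {ι : Type*} [Fintype ι] [Nonempty ι] {w p q : ι → ℝ} {α c : ℝ}
    (hα : 0 < α) (hw : ∀ i, 0 < w i) (hp : ∀ i, 0 < p i) (hq : ∀ i, 0 < q i)
    (hpq : ∀ i, p i ≤ Real.exp (α * c) * q i) :
    1 / α * Real.log (∑ i, w i * p i) ≤ 1 / α * Real.log (∑ i, w i * q i) + c := by
  have hps : 0 < ∑ i, w i * p i :=
    Finset.sum_pos (fun i _ => mul_pos (hw i) (hp i)) Finset.univ_nonempty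
  have hqs : 0 < ∑ i, w i * q i :=
    Finset.sum_pos (fun i _ => mul_pos (hw i) (hq i)) Finset.univ_nonempty
  have hle : ∑ i, w i * p i ≤ Real.exp (α * c) * ∑ i, w i * q i := by
    rw [Finset.mul_sum]
    refine Finset.sum_le_sum fun i _ => ?_
    rw [mul_left_comm]
    exact mul_le_mul_of_nonneg_left (hpq i) (hw i).le
  have hlog := Real.log_le_log hps hle
  rw [Real.log_mul (Real.exp_pos _).ne' hqs.ne', Real.log_exp] at hlog
  calc 1 / α * Real.log (∑ i, w i * p i)
      ≤ 1 / α * (α * c + Real.log (∑ i, w i * q i)) :=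
        mul_le_mul_of_nonneg_left hlog (by positivity)
    _ = 1 / α * Real.log (∑ i, w i * q i) + c := by field_simp; ring

/-- The generalized Bellman operator
`(B F) s = (1/α)·log ∑ a, ρ s a · (∫ exp (β·∑ s', Tθ θ a s s' · (R s a s' + γ·F s')) dμ(θ|a,s))^(α/β)`
is a γ-contraction in the supremum norm:
`⨆ s, |B F s − B G s| ≤ γ · ⨆ s, |F s − G s|` for all bounded F, G. -/
theorem stmt12 {S A : Type*} [Fintype S] [Nonempty S] [Fintype A] [Nonempty A]
    {Θ : Type*} [MeasurableSpace Θ]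
    (ρ : S → A → ℝ) (hρpos : ∀ s a, 0 < ρ s a) (hρsum : ∀ s, ∑ a, ρ s a = 1)
    (μ : A → S → Measure Θ) (hμ : ∀ a s, IsProbabilityMeasure (μ a s))
    (Tθ : Θ → A → S → S → ℝ)
    (hT0 : ∀ θ a s s', 0 ≤ Tθ θ a s s') (hT1 : ∀ θ a s, ∑ s', Tθ θ a s s' = 1)
    (hTmeas : ∀ a s s', Measurable (fun θ => Tθ θ a s s'))
    (R : S → A → S → ℝ) (CR : ℝ) (hR : ∀ s a s', |R s a s'| ≤ CR)
    (α : ℝ) (hα : 0 < α) (β : ℝ) (hβ : β ≠ 0)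
    (γ : ℝ) (hγ0 : 0 < γ) (hγ1 : γ < 1)
    (B : (S → ℝ) → (S → ℝ))
    (hB : ∀ F s, B F s = (1/α) * Real.log (∑ a, ρ s a *
      (∫ θ, Real.exp (β * ∑ s', Tθ θ a s s' * (R s a s' + γ * F s')) ∂(μ a s)) ^ (α/β)))
    (F G : S → ℝ) :
    (⨆ s, |B F s - B G s|) ≤ γ * ⨆ s, |F s - G s| := by
  set D := ⨆ s, |F s - G s|
  have hFG : ∀ s, |F s - G s| ≤ D := le_ciSup (Set.finite_range fun s => |F s - G s|).bddAbove
  have hint : ∀ (H : S → ℝ) (a : A) (s : S), Integrable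
      (fun θ => Real.exp (β * ∑ s', Tθ θ a s s' * (R s a s' + γ * H s'))) (μ a s) := by
    intro H a s
    have := hμ a s
    obtain ⟨C, hC⟩ := (Set.finite_range fun s' => |R s a s' + γ * H s'|).bddAbove
    refine integrable_exp_mul_of_abs_le
      (Finset.measurable_sum _ fun s' _ => (hTmeas a s s').mul_const _) (C := C) (fun θ => ?_) β
    exact abs_sum_mul_le_of_sum_eq_one (hT0 θ a s) (hT1 θ a s) fun s' => hC ⟨s', rfl⟩
  have hone : ∀ H K : S → ℝ, (∀ s, |H s - K s| ≤ D) → ∀ s, B H s ≤ B K s + γ * D := by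
    intro H K hHK s
    have hpos : ∀ (L : S → ℝ) (a : A), 0 < (∫ θ, Real.exp
        (β * ∑ s', Tθ θ a s s' * (R s a s' + γ * L s')) ∂(μ a s)) ^ (α / β) := by
      intro L a
      have := hμ a s
      exact Real.rpow_pos_of_pos (integral_exp_pos (hint L a s)) _
    rw [hB, hB]
    refine log_sum_mul_le_add hα (hρpos s) (hpos H) (hpos K) fun a => ?_
    have := hμ a s
    refine integral_exp_rpow_le hα hβ (hint H a s) (hint K a s) fun θ => ?_
    rw [← sub_le_iff_le_add', ← Finset.sum_sub_distrib]
    simp_rw [← mul_sub, add_sub_add_left_eq_sub, ← mul_sub]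
    refine (le_abs_self _).trans
      (abs_sum_mul_le_of_sum_eq_one (hT0 θ a s) (hT1 θ a s) fun s' => ?_)
    rw [abs_mul, abs_of_pos hγ0]
    exact mul_le_mul_of_nonneg_left (hHK s') hγ0.le
  refine ciSup_le fun s => abs_sub_le_iff.2 ⟨?_, ?_⟩
  · exact sub_le_iff_le_add'.2 (hone F G hFG s)
  · exact sub_le_iff_le_add'.2 (hone G F (fun t => abs_sub_comm (F t) (G t) ▸ hFG t) s)
end

section
/- The operator B has exactly one fixed point among bounded functions: there exists a unique bounded F* : S → ℝ such that B F* = F*. -/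
open MeasureTheory

lemma integrable_exp_mul_sum {Θ S : Type*} [MeasurableSpace Θ] [Fintype S] (ν : Measure Θ)
    [IsFiniteMeasure ν] (t : Θ → S → ℝ) (ht0 : ∀ θ s, 0 ≤ t θ s) (ht1 : ∀ θ, ∑ s, t θ s = 1)
    (ht : ∀ s, Measurable fun θ => t θ s) (c : S → ℝ) (β : ℝ) :
    Integrable (fun θ => Real.exp (β * ∑ s, t θ s * c s)) ν := by
  refine Integrable.of_bound (C := Real.exp (|β| * ∑ s, |c s|))
    (Measurable.aestronglyMeasurable (by fun_prop)) (Filter.Eventually.of_forall fun θ => ?_)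
  have hle : ∀ s, t θ s ≤ 1 := fun s =>
    (Finset.single_le_sum (fun i _ => ht0 θ i) (Finset.mem_univ s)).trans_eq (ht1 θ)
  rw [Real.norm_eq_abs, Real.abs_exp, Real.exp_le_exp]
  refine (le_abs_self _).trans ?_
  rw [abs_mul]
  refine mul_le_mul_of_nonneg_left ((Finset.abs_sum_le_sum_abs _ _).trans ?_) (abs_nonneg β)
  refine Finset.sum_le_sum fun s _ => ?_
  rw [abs_mul, abs_of_nonneg (ht0 θ s)]
  exact mul_le_of_le_one_left (abs_nonneg _) (hle s)

lemma rpow_integral_exp_le {Θ : Type*} [MeasurableSpace Θ] (ν : Measure Θ) [NeZero ν]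
    {X Y : Θ → ℝ} {α β e : ℝ} (hα : 0 < α) (hβ : β ≠ 0)
    (hX : Integrable (fun θ => Real.exp (β * X θ)) ν)
    (hY : Integrable (fun θ => Real.exp (β * Y θ)) ν) (h : ∀ θ, X θ ≤ Y θ + e) :
    (∫ θ, Real.exp (β * X θ) ∂ν) ^ (α / β) ≤
      Real.exp (α * e) * (∫ θ, Real.exp (β * Y θ) ∂ν) ^ (α / β) := by
  have hXpos := integral_exp_pos hX
  have hYpos := integral_exp_pos hY
  have hexp : Real.exp (α * e) = Real.exp (β * e) ^ (α / β) := by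
    rw [← Real.exp_mul]
    congr 1
    field_simp
  rw [hexp, ← Real.mul_rpow (Real.exp_pos _).le hYpos.le]
  rcases hβ.lt_or_gt with hneg | hpos
  · refine Real.rpow_le_rpow_of_nonpos (by positivity) ?_ (div_neg_of_pos_of_neg hα hneg).le
    rw [← integral_const_mul]
    refine integral_mono (hY.const_mul _) hX fun θ => ?_
    simp only
    rw [← Real.exp_add, Real.exp_le_exp]
    nlinarith [h θ]
  · refine Real.rpow_le_rpow hXpos.le ?_ (div_pos hα hpos).le
    rw [← integral_const_mul]
    refine integral_mono hX (hY.const_mul _) fun θ => ?_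
    simp only
    rw [← Real.exp_add, Real.exp_le_exp]
    nlinarith [h θ]

lemma existsUnique_fixedPoint_of_sub_le {S : Type*} [Fintype S] {γ : ℝ} (hγ0 : 0 ≤ γ)
    (hγ1 : γ < 1) (B : (S → ℝ) → S → ℝ)
    (h : ∀ F G d, (∀ s, F s ≤ G s + d) → ∀ s, B F s ≤ B G s + γ * d) :
    ∃! F, B F = F := by
  have hdist : ∀ F G : S → ℝ, ∀ s, F s ≤ G s + dist F G := fun F G s => by
    have := (le_abs_self _).trans (dist_le_pi_dist F G s)
    linarith
  have hB : ContractingWith ⟨γ, hγ0⟩ B := by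
    refine ⟨hγ1, LipschitzWith.of_dist_le_mul fun F G => ?_⟩
    refine (dist_pi_le_iff (mul_nonneg hγ0 dist_nonneg)).2 fun s => ?_
    rw [Real.dist_eq, abs_le]
    have h₁ := h F G _ (hdist F G) s
    have h₂ := h G F _ (hdist G F) s
    rw [dist_comm G F] at h₂
    change -(γ * dist F G) ≤ _ ∧ _ ≤ γ * dist F G
    constructor <;> linarith
  exact ⟨hB.fixedPoint, hB.fixedPoint_isFixedPt, fun _ hF => hB.fixedPoint_unique hF⟩

/-- The generalized Bellman operator B has exactly one fixed point among
(bounded) functions S → ℝ: there exists a unique F* : S → ℝ with B F* = F*.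
(Since S is finite, every function S → ℝ is bounded.) -/
theorem stmt13 {S A : Type*} [Fintype S] [Nonempty S] [Fintype A] [Nonempty A]
    {Θ : Type*} [MeasurableSpace Θ]
    (ρ : S → A → ℝ) (hρpos : ∀ s a, 0 < ρ s a) (hρsum : ∀ s, ∑ a, ρ s a = 1)
    (μ : A → S → Measure Θ) (hμ : ∀ a s, IsProbabilityMeasure (μ a s))
    (Tθ : Θ → A → S → S → ℝ)
    (hT0 : ∀ θ a s s', 0 ≤ Tθ θ a s s') (hT1 : ∀ θ a s, ∑ s', Tθ θ a s s' = 1)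
    (hTmeas : ∀ a s s', Measurable (fun θ => Tθ θ a s s'))
    (R : S → A → S → ℝ) (CR : ℝ) (hR : ∀ s a s', |R s a s'| ≤ CR)
    (α : ℝ) (hα : 0 < α) (β : ℝ) (hβ : β ≠ 0)
    (γ : ℝ) (hγ0 : 0 < γ) (hγ1 : γ < 1)
    (B : (S → ℝ) → (S → ℝ))
    (hB : ∀ F s, B F s = (1/α) * Real.log (∑ a, ρ s a *
      (∫ θ, Real.exp (β * ∑ s', Tθ θ a s s' * (R s a s' + γ * F s')) ∂(μ a s)) ^ (α/β))) :
    ∃! Fstar : S → ℝ, B Fstar = Fstar := by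
  refine existsUnique_fixedPoint_of_sub_le hγ0.le hγ1 B fun F G d hFG s => ?_
  have hint : ∀ (F : S → ℝ) a, Integrable (fun θ =>
      Real.exp (β * ∑ s', Tθ θ a s s' * (R s a s' + γ * F s'))) (μ a s) := fun F a =>
    integrable_exp_mul_sum (μ a s) (fun θ => Tθ θ a s) (fun θ => hT0 θ a s)
      (fun θ => hT1 θ a s) (hTmeas a s) _ β
  have hpos : ∀ F : S → ℝ, 0 < ∑ a, ρ s a *
      (∫ θ, Real.exp (β * ∑ s', Tθ θ a s s' * (R s a s' + γ * F s')) ∂(μ a s)) ^ (α/β) :=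
    fun F => Finset.sum_pos (fun a _ => mul_pos (hρpos s a)
      (Real.rpow_pos_of_pos (integral_exp_pos (hint F a)) _)) Finset.univ_nonempty
  have hX : ∀ a θ, ∑ s', Tθ θ a s s' * (R s a s' + γ * F s') ≤
      ∑ s', Tθ θ a s s' * (R s a s' + γ * G s') + γ * d := fun a θ => by
    rw [← one_mul (γ * d), ← hT1 θ a s, Finset.sum_mul, ← Finset.sum_add_distrib]
    refine Finset.sum_le_sum fun s' _ => ?_
    rw [← mul_add]
    refine mul_le_mul_of_nonneg_left ?_ (hT0 θ a s s')
    nlinarith [hFG s']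
  have hsum : ∑ a, ρ s a *
      (∫ θ, Real.exp (β * ∑ s', Tθ θ a s s' * (R s a s' + γ * F s')) ∂(μ a s)) ^ (α/β) ≤
      Real.exp (α * (γ * d)) * ∑ a, ρ s a *
      (∫ θ, Real.exp (β * ∑ s', Tθ θ a s s' * (R s a s' + γ * G s')) ∂(μ a s)) ^ (α/β) := by
    rw [Finset.mul_sum]
    refine Finset.sum_le_sum fun a _ => ?_
    rw [mul_left_comm]
    exact mul_le_mul_of_nonneg_left
      (rpow_integral_exp_le (μ a s) hα hβ (hint F a) (hint G a) (hX a)) (hρpos s a).le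
  have hlog := Real.log_le_log (hpos F) hsum
  rw [Real.log_mul (Real.exp_pos _).ne' (hpos G).ne', Real.log_exp] at hlog
  rw [hB, hB]
  refine (mul_le_mul_of_nonneg_left hlog (one_div_pos.2 hα).le).trans_eq ?_
  field_simp
  ring
end

section
/- Let β < 0. Suppose there exists a pair (π*, ψ*) realizing the max-min free energy, i.e. F_{π*,ψ*}(s) = sup_π inf_ψ F_{π,ψ}(s) for all s ∈ S (where π ranges over policies and ψ over admissible beliefs), with ψ* attaining the inner infimum for π* and π* attaining the outer supremum, and set F* = F_{π*,ψ*}. Suppose moreover that the operator (B F)(s) = sup_π inf_ψ (T_{π,ψ} F)(s) is attained at F* by some admissible pair. Then F* = B F*; and F* is the unique such fixed point: if F' = F_{π'',ψ''} for some admissible pair (π'', ψ'') and F' = B F', then F' = F*. -/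
open MeasureTheory

/-- A monotone operator on real-valued functions that shrinks additive shifts by the factor `γ`
(Blackwell's conditions, in one inequality). -/
def IsDiscounted {S : Type*} (γ : ℝ) (T : (S → ℝ) → S → ℝ) : Prop :=
  ∀ (F G : S → ℝ) (d : ℝ), (∀ s, F s ≤ G s + d) → ∀ s, T F s ≤ T G s + γ * d

namespace IsDiscounted

variable {S : Type*} {γ : ℝ} {T : (S → ℝ) → S → ℝ}

theorem le_of_le_apply [Fintype S] [Nonempty S] (hT : IsDiscounted γ T) (hγ1 : γ < 1)
    {F G : S → ℝ} (hF : ∀ s, F s ≤ T F s) (hG : ∀ s, T G s ≤ G s) (s : S) : F s ≤ G s := by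
  obtain ⟨m, hm⟩ := Finite.exists_max fun s => F s - G s
  have h := hT F G (F m - G m) (fun s => by linarith [hm s]) m
  nlinarith [hF m, hG m, hm s]

theorem mono (hT : IsDiscounted γ T) {F G : S → ℝ} (h : ∀ s, F s ≤ G s) (s : S) :
    T F s ≤ T G s := by
  simpa using hT F G 0 (by simpa using h) s

theorem exists_fixedPoint [Fintype S] (hT : IsDiscounted γ T) (hγ0 : 0 ≤ γ) (hγ1 : γ < 1) :
    ∃ F, T F = F := by
  have hc : ContractingWith ⟨γ, hγ0⟩ T := by
    refine ⟨by exact_mod_cast hγ1, LipschitzWith.of_dist_le_mul fun F G => ?_⟩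
    refine (dist_pi_le_iff (by positivity)).2 fun s => ?_
    have hFG : ∀ s, |F s - G s| ≤ dist F G := fun s => dist_le_pi_dist F G s
    have h1 := hT F G (dist F G) (fun s => by linarith [le_abs_self (F s - G s), hFG s]) s
    have h2 := hT G F (dist F G) (fun s => by linarith [neg_abs_le (F s - G s), hFG s]) s
    change dist (T F s) (T G s) ≤ γ * dist F G
    rw [Real.dist_eq, abs_le]
    constructor <;> linarith
  exact ⟨_, hc.fixedPoint_isFixedPt⟩

theorem neg_div_le_of_fixedPoint [Fintype S] [Nonempty S] (hT : IsDiscounted γ T) (hγ1 : γ < 1)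
    {F : S → ℝ} (hF : T F = F) {M : ℝ} (hM : ∀ s, -M ≤ T 0 s) (s : S) :
    -(M / (1 - γ)) ≤ F s := by
  refine hT.le_of_le_apply hγ1 (F := fun _ => -(M / (1 - γ))) (fun s => ?_)
    (fun s => (congrFun hF s).le) s
  have h := hT 0 (fun _ => -(M / (1 - γ))) (M / (1 - γ)) (by simp) s
  have h' : M / (1 - γ) * (1 - γ) = M := div_mul_cancel₀ _ (by linarith)
  linarith [hM s]

theorem le_div_of_fixedPoint [Fintype S] [Nonempty S] (hT : IsDiscounted γ T) (hγ1 : γ < 1)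
    {F : S → ℝ} (hF : T F = F) {M : ℝ} (hM : ∀ s, T 0 s ≤ M) (s : S) :
    F s ≤ M / (1 - γ) := by
  refine hT.le_of_le_apply hγ1 (G := fun _ => M / (1 - γ)) (fun s => (congrFun hF s).ge)
    (fun s => ?_) s
  have h := hT (fun _ => M / (1 - γ)) 0 (M / (1 - γ)) (by simp) s
  have h' : M / (1 - γ) * (1 - γ) = M := div_mul_cancel₀ _ (by linarith)
  linarith [hM s]

end IsDiscounted

section MaxMin

variable {S P Q : Type*} [Fintype S] {γ : ℝ} {Pol : P → Prop} {Bel : Q → Prop}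
  {T : P → Q → (S → ℝ) → S → ℝ}

theorem bddBelow_apply (hT : ∀ π ψ, Pol π → Bel ψ → IsDiscounted γ (T π ψ))
    (hlow : ∀ π, Pol π → ∃ M, ∀ ψ, Bel ψ → ∀ s, -M ≤ T π ψ 0 s)
    {π : P} (hπ : Pol π) (F : S → ℝ) (s : S) :
    BddBelow {y : ℝ | ∃ ψ, Bel ψ ∧ y = T π ψ F s} := by
  obtain ⟨M, hM⟩ := hlow π hπ
  refine ⟨-M - γ * ‖F‖, ?_⟩
  rintro _ ⟨ψ, hψ, rfl⟩
  have h := hT π ψ hπ hψ 0 F ‖F‖ (fun s => by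
    have := norm_le_pi_norm F s
    rw [Real.norm_eq_abs] at this
    simp only [Pi.zero_apply]
    linarith [neg_abs_le (F s)]) s
  linarith [hM ψ hψ s]

theorem bddAbove_sInf_apply (hT : ∀ π ψ, Pol π → Bel ψ → IsDiscounted γ (T π ψ))
    (hlow : ∀ π, Pol π → ∃ M, ∀ ψ, Bel ψ → ∀ s, -M ≤ T π ψ 0 s)
    (hupp : ∀ ψ, Bel ψ → ∃ M, ∀ π, Pol π → ∀ s, T π ψ 0 s ≤ M)
    (hne : ∃ ψ, Bel ψ) (F : S → ℝ) (s : S) :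
    BddAbove {x : ℝ | ∃ π, Pol π ∧ x = sInf {y : ℝ | ∃ ψ, Bel ψ ∧ y = T π ψ F s}} := by
  obtain ⟨ψ, hψ⟩ := hne
  obtain ⟨M, hM⟩ := hupp ψ hψ
  refine ⟨M + γ * ‖F‖, ?_⟩
  rintro _ ⟨π, hπ, rfl⟩
  refine (csInf_le (bddBelow_apply hT hlow hπ F s) ⟨ψ, hψ, rfl⟩).trans ?_
  have h := hT π ψ hπ hψ F 0 ‖F‖ (fun s => by
    have := norm_le_pi_norm F s
    rw [Real.norm_eq_abs] at this
    simp only [Pi.zero_apply]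
    linarith [le_abs_self (F s)]) s
  linarith [hM π hπ s]

theorem bddBelow_fixedPoint [Nonempty S] (hγ1 : γ < 1)
    (hT : ∀ π ψ, Pol π → Bel ψ → IsDiscounted γ (T π ψ))
    (hlow : ∀ π, Pol π → ∃ M, ∀ ψ, Bel ψ → ∀ s, -M ≤ T π ψ 0 s)
    {π : P} (hπ : Pol π) (s : S) :
    BddBelow {y : ℝ | ∃ ψ F, Bel ψ ∧ T π ψ F = F ∧ y = F s} := by
  obtain ⟨M, hM⟩ := hlow π hπ
  refine ⟨-(M / (1 - γ)), ?_⟩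
  rintro _ ⟨ψ, F, hψ, hF, rfl⟩
  exact (hT π ψ hπ hψ).neg_div_le_of_fixedPoint hγ1 hF (hM ψ hψ) s

theorem bddAbove_sInf_fixedPoint [Nonempty S] (hγ0 : 0 ≤ γ) (hγ1 : γ < 1)
    (hT : ∀ π ψ, Pol π → Bel ψ → IsDiscounted γ (T π ψ))
    (hlow : ∀ π, Pol π → ∃ M, ∀ ψ, Bel ψ → ∀ s, -M ≤ T π ψ 0 s)
    (hupp : ∀ ψ, Bel ψ → ∃ M, ∀ π, Pol π → ∀ s, T π ψ 0 s ≤ M)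
    (hne : ∃ ψ, Bel ψ) (s : S) :
    BddAbove {x : ℝ | ∃ π, Pol π ∧
      x = sInf {y : ℝ | ∃ ψ F, Bel ψ ∧ T π ψ F = F ∧ y = F s}} := by
  obtain ⟨ψ, hψ⟩ := hne
  obtain ⟨M, hM⟩ := hupp ψ hψ
  refine ⟨M / (1 - γ), ?_⟩
  rintro _ ⟨π, hπ, rfl⟩
  obtain ⟨F, hF⟩ := (hT π ψ hπ hψ).exists_fixedPoint hγ0 hγ1
  exact (csInf_le (bddBelow_fixedPoint hγ1 hT hlow hπ s) ⟨ψ, F, hψ, hF, rfl⟩).trans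
    ((hT π ψ hπ hψ).le_div_of_fixedPoint hγ1 hF (hM π hπ) s)

theorem IsDiscounted.sSup_sInf (hT : ∀ π ψ, Pol π → Bel ψ → IsDiscounted γ (T π ψ))
    (hlow : ∀ π, Pol π → ∃ M, ∀ ψ, Bel ψ → ∀ s, -M ≤ T π ψ 0 s)
    (hupp : ∀ ψ, Bel ψ → ∃ M, ∀ π, Pol π → ∀ s, T π ψ 0 s ≤ M)
    (hneP : ∃ π, Pol π) (hneQ : ∃ ψ, Bel ψ) :
    IsDiscounted γ fun F s => sSup {x : ℝ | ∃ π, Pol π ∧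
      x = sInf {y : ℝ | ∃ ψ, Bel ψ ∧ y = T π ψ F s}} := by
  intro F G d h s
  obtain ⟨π₀, hπ₀⟩ := hneP
  obtain ⟨ψ₀, hψ₀⟩ := hneQ
  refine csSup_le ⟨_, π₀, hπ₀, rfl⟩ ?_
  rintro _ ⟨π, hπ, rfl⟩
  suffices sInf {y : ℝ | ∃ ψ, Bel ψ ∧ y = T π ψ F s} - γ * d ≤
      sInf {y : ℝ | ∃ ψ, Bel ψ ∧ y = T π ψ G s} by
    have := le_csSup (bddAbove_sInf_apply hT hlow hupp ⟨ψ₀, hψ₀⟩ G s) ⟨π, hπ, rfl⟩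
    linarith
  refine le_csInf ⟨_, ψ₀, hψ₀, rfl⟩ ?_
  rintro _ ⟨ψ, hψ, rfl⟩
  have := csInf_le (bddBelow_apply hT hlow hπ F s) ⟨ψ, hψ, rfl⟩
  linarith [hT π ψ hπ hψ F G d h s]

/-- If `F` is the least fixed-point vector over all beliefs, then no belief decreases `F` in one
step. -/
theorem le_apply_of_eq_sInf_fixedPoint [Nonempty S] (hγ0 : 0 ≤ γ) (hγ1 : γ < 1)
    (hT : ∀ π ψ, Pol π → Bel ψ → IsDiscounted γ (T π ψ))
    (hlow : ∀ π, Pol π → ∃ M, ∀ ψ, Bel ψ → ∀ s, -M ≤ T π ψ 0 s)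
    (hmix : ∀ ψ ψ', Bel ψ → Bel ψ' → ∀ s, ∃ φ, Bel φ ∧ ∀ π F,
      T π φ F s = T π ψ F s ∧ ∀ s', s' ≠ s → T π φ F s' = T π ψ' F s')
    {π : P} {ψ : Q} {F : S → ℝ} (hπ : Pol π) (hψ : Bel ψ) (hfix : T π ψ F = F)
    (hinner : ∀ s, F s = sInf {y : ℝ | ∃ ψ F, Bel ψ ∧ T π ψ F = F ∧ y = F s})
    {ψ' : Q} (hψ' : Bel ψ') (s : S) : F s ≤ T π ψ' F s := by
  by_contra! hlt
  obtain ⟨φ, hφ, hmixed⟩ := hmix ψ' ψ hψ' hψ s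
  obtain ⟨hs, hs'⟩ := hmixed π F
  have hle : ∀ t, T π φ F t ≤ F t := fun t => by
    by_cases hts : t = s
    · rw [hts, hs]; exact hlt.le
    · rw [hs' t hts, hfix]
  obtain ⟨G, hG⟩ := (hT π φ hπ hφ).exists_fixedPoint hγ0 hγ1
  have hGF := (hT π φ hπ hφ).le_of_le_apply hγ1 (fun t => (congrFun hG t).ge) hle
  have h1 := (hT π φ hπ hφ).mono hGF s
  have h2 := csInf_le (bddBelow_fixedPoint hγ1 hT hlow hπ s) ⟨φ, G, hφ, hG, rfl⟩
  rw [← hinner s] at h2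
  rw [hG] at h1
  linarith

/-- The Bellman equation for a max-min value vector. -/
theorem eq_sSup_sInf_apply [Nonempty S] (hγ0 : 0 ≤ γ) (hγ1 : γ < 1)
    (hT : ∀ π ψ, Pol π → Bel ψ → IsDiscounted γ (T π ψ))
    (hlow : ∀ π, Pol π → ∃ M, ∀ ψ, Bel ψ → ∀ s, -M ≤ T π ψ 0 s)
    (hupp : ∀ ψ, Bel ψ → ∃ M, ∀ π, Pol π → ∀ s, T π ψ 0 s ≤ M)
    (hmixQ : ∀ ψ ψ', Bel ψ → Bel ψ' → ∀ s, ∃ φ, Bel φ ∧ ∀ π F,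
      T π φ F s = T π ψ F s ∧ ∀ s', s' ≠ s → T π φ F s' = T π ψ' F s')
    (hmixP : ∀ π π', Pol π → Pol π' → ∀ s, ∃ σ, Pol σ ∧ ∀ ψ F,
      T σ ψ F s = T π ψ F s ∧ ∀ s', s' ≠ s → T σ ψ F s' = T π' ψ F s')
    {π : P} {ψ : Q} {F : S → ℝ} (hπ : Pol π) (hψ : Bel ψ) (hfix : T π ψ F = F)
    (hsupinf : ∀ s, F s = sSup {x : ℝ | ∃ π, Pol π ∧
      x = sInf {y : ℝ | ∃ ψ F, Bel ψ ∧ T π ψ F = F ∧ y = F s}})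
    (hinner : ∀ s, F s = sInf {y : ℝ | ∃ ψ F, Bel ψ ∧ T π ψ F = F ∧ y = F s}) (s : S) :
    F s = sSup {x : ℝ | ∃ π, Pol π ∧ x = sInf {y : ℝ | ∃ ψ, Bel ψ ∧ y = T π ψ F s}} := by
  have hstep : ∀ ψ', Bel ψ' → ∀ s, F s ≤ T π ψ' F s := fun ψ' hψ' s =>
    le_apply_of_eq_sInf_fixedPoint hγ0 hγ1 hT hlow hmixQ hπ hψ hfix hinner hψ' s
  apply le_antisymm
  · refine le_csSup_of_le (bddAbove_sInf_apply hT hlow hupp ⟨ψ, hψ⟩ F s) ⟨π, hπ, rfl⟩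
      (le_csInf ⟨_, ψ, hψ, rfl⟩ ?_)
    rintro _ ⟨ψ', hψ', rfl⟩
    exact hstep ψ' hψ' s
  · refine csSup_le ⟨_, π, hπ, rfl⟩ ?_
    rintro _ ⟨π', hπ', rfl⟩
    by_contra! hlt
    obtain ⟨σ, hσ, hmixed⟩ := hmixP π' π hπ' hπ s
    set v := sInf {y : ℝ | ∃ ψ, Bel ψ ∧ y = T π' ψ F s}
    have hv : ∀ φ, Bel φ → v ≤ T σ φ F s := fun φ hφ => by
      rw [(hmixed φ F).1]
      exact csInf_le (bddBelow_apply hT hlow hπ' F s) ⟨φ, hφ, rfl⟩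
    have hge : v ≤ sInf {y : ℝ | ∃ ψ F, Bel ψ ∧ T σ ψ F = F ∧ y = F s} := by
      obtain ⟨G₀, hG₀⟩ := (hT σ ψ hσ hψ).exists_fixedPoint hγ0 hγ1
      refine le_csInf ⟨_, ψ, G₀, hψ, hG₀, rfl⟩ ?_
      rintro _ ⟨φ, G, hφ, hG, rfl⟩
      have hle : ∀ t, F t ≤ T σ φ F t := fun t => by
        by_cases hts : t = s
        · rw [hts]; exact hlt.le.trans (hv φ hφ)
        · rw [(hmixed φ F).2 t hts]; exact hstep φ hφ t
      have hFG := (hT σ φ hσ hφ).le_of_le_apply hγ1 hle (fun t => (congrFun hG t).le)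
      have h1 := (hT σ φ hσ hφ).mono hFG s
      rw [hG] at h1
      exact (hv φ hφ).trans h1
    have hsup := le_csSup (bddAbove_sInf_fixedPoint hγ0 hγ1 hT hlow hupp ⟨ψ, hψ⟩ s)
      ⟨σ, hσ, rfl⟩
    rw [← hsupinf s] at hsup
    linarith

end MaxMin

theorem integral_log_rnDeriv_nonneg {Θ : Type*} [MeasurableSpace Θ] (ψ μ : Measure Θ)
    [IsProbabilityMeasure ψ] [IsProbabilityMeasure μ] (h : ψ ≪ μ) :
    0 ≤ ∫ θ, Real.log ((ψ.rnDeriv μ θ).toReal) ∂ψ := by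
  have := InformationTheory.toReal_klDiv_of_measure_eq h (by simp)
  simp only [llr] at this
  rw [← this]
  exact ENNReal.toReal_nonneg

theorem mul_neg_log_div_le {p r : ℝ} (hp : 0 ≤ p) (hr : 0 < r) :
    p * -Real.log (p / r) ≤ r := by
  rcases hp.eq_or_lt with rfl | hp
  · simpa using hr.le
  · have h := Real.log_le_sub_one_of_pos (div_pos hr hp)
    rw [← Real.log_inv, inv_div]
    calc p * Real.log (r / p) ≤ p * (r / p - 1) := by gcongr
      _ = r - p := by field_simp
      _ ≤ r := by linarith

/-- Integral form of the belief term, with the dependence on `F` separated. -/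
theorem integral_belief_eq {S Θ : Type*} [Fintype S] [MeasurableSpace Θ] (ψ : Measure Θ)
    [IsProbabilityMeasure ψ] {l : Θ → ℝ} (hl : Integrable l ψ) {t : Θ → S → ℝ}
    (ht : ∀ s', Integrable (fun θ => t θ s') ψ) (c γ : ℝ) (r F : S → ℝ) :
    ∫ θ, (c * l θ + ∑ s', t θ s' * (r s' + γ * F s')) ∂ψ =
      c * ∫ θ, l θ ∂ψ + ∑ s', (∫ θ, t θ s' ∂ψ) * (r s' + γ * F s') := by
  rw [integral_add (hl.const_mul c) (integrable_finsetSum _ fun s' _ => (ht s').mul_const _),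
    integral_const_mul, integral_finsetSum _ fun s' _ => (ht s').mul_const _]
  simp only [integral_mul_const]

theorem abs_sum_mul_le_of_sum_eq_one_s18 {ι : Type*} [Fintype ι] {p f : ι → ℝ} {C : ℝ}
    (hp0 : ∀ i, 0 ≤ p i) (hp1 : ∑ i, p i = 1) (hf : ∀ i, |f i| ≤ C) : |∑ i, p i * f i| ≤ C :=
  calc |∑ i, p i * f i| ≤ ∑ i, |p i * f i| := Finset.abs_sum_le_sum_abs _ _
    _ ≤ ∑ i, p i * C := by
      gcongr with i
      rw [abs_mul, abs_of_nonneg (hp0 i)]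
      exact mul_le_mul_of_nonneg_left (hf i) (hp0 i)
    _ = C := by rw [← Finset.sum_mul, hp1, one_mul]

/-- β < 0: Suppose the admissible pair (π*, ψ*) realizes the max-min free
energy, i.e. its free-energy vector F* = F_{π*,ψ*} satisfies
`F* s = sup_π inf_ψ F_{π,ψ} s` for all s, with ψ* attaining the inner infimum for π* and π*
attaining the outer supremum, and suppose the operator
`(B F) s = sup_π inf_ψ (T_{π,ψ} F) s` is attained at F* by some admissible pair.
Then F* = B F*, and F* is the unique such fixed point: any F' that is the free-energy vector
of an admissible pair and satisfies F' = B F' equals F*. -/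
theorem stmt18 {S A : Type*} [Fintype S] [Nonempty S] [Fintype A] [Nonempty A]
    {Θ : Type*} [MeasurableSpace Θ]
    (ρ : S → A → ℝ) (hρpos : ∀ s a, 0 < ρ s a) (hρsum : ∀ s, ∑ a, ρ s a = 1)
    (μ : A → S → Measure Θ) (hμ : ∀ a s, IsProbabilityMeasure (μ a s))
    (Tθ : Θ → A → S → S → ℝ)
    (hT0 : ∀ θ a s s', 0 ≤ Tθ θ a s s') (hT1 : ∀ θ a s, ∑ s', Tθ θ a s s' = 1)
    (hTmeas : ∀ a s s', Measurable (fun θ => Tθ θ a s s'))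
    (R : S → A → S → ℝ) (CR : ℝ) (hR : ∀ s a s', |R s a s'| ≤ CR)
    (α : ℝ) (hα : 0 < α) (β : ℝ) (hβ : β < 0)
    (γ : ℝ) (hγ0 : 0 < γ) (hγ1 : γ < 1)
    -- policies and beliefs
    (Pol : (S → A → ℝ) → Prop)
    (hPol : ∀ π, Pol π ↔ ((∀ s a, 0 ≤ π s a) ∧ ∀ s, ∑ a, π s a = 1))
    (Bel : (A → S → Measure Θ) → Prop)
    (hBel : ∀ ψ, Bel ψ ↔ ∀ a s, IsProbabilityMeasure (ψ a s) ∧ ψ a s ≪ μ a s ∧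
      Integrable (fun θ => Real.log (((ψ a s).rnDeriv (μ a s) θ).toReal)) (ψ a s))
    -- the operator T_{π,ψ}
    (Top : (S → A → ℝ) → (A → S → Measure Θ) → (S → ℝ) → (S → ℝ))
    (hTop : ∀ π ψ F s, Top π ψ F s = ∑ a, π s a * ( -(1/α) * Real.log (π s a / ρ s a)
      + ∫ θ, ( -(1/β) * Real.log (((ψ a s).rnDeriv (μ a s) θ).toReal)
          + ∑ s', Tθ θ a s s' * (R s a s' + γ * F s') ) ∂(ψ a s) ))
    -- the operator (B F) s = sup over policies of inf over beliefs of (T_{π,ψ} F) s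
    (B : (S → ℝ) → (S → ℝ))
    (hB : ∀ F s, B F s = sSup {x : ℝ | ∃ π, Pol π ∧
      x = sInf {y : ℝ | ∃ ψ, Bel ψ ∧ y = Top π ψ F s}})
    -- the admissible pair (π*, ψ*) with free-energy vector F* realizing the max-min
    (πstar : S → A → ℝ) (ψstar : A → S → Measure Θ) (Fstar : S → ℝ)
    (hπstar : Pol πstar) (hψstar : Bel ψstar)
    (hfixstar : Top πstar ψstar Fstar = Fstar)
    -- F* realizes the outer supremum of the inner infima of the free-energy vectors
    (hsupinf : ∀ s, Fstar s = sSup {x : ℝ | ∃ π, Pol π ∧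
      x = sInf {y : ℝ | ∃ ψ F, Bel ψ ∧ Top π ψ F = F ∧ y = F s}})
    -- ψ* attains the inner infimum for π*
    (hinner : ∀ s, Fstar s = sInf {y : ℝ | ∃ ψ F, Bel ψ ∧ Top πstar ψ F = F ∧ y = F s})
    -- B F* is attained by some admissible pair
    (hattain : ∃ π' ψ', Pol π' ∧ Bel ψ' ∧ ∀ s, B Fstar s = Top π' ψ' Fstar s) :
    Fstar = B Fstar ∧
    (∀ (π'' : S → A → ℝ) (ψ'' : A → S → Measure Θ) (F' : S → ℝ),
      Pol π'' → Bel ψ'' → Top π'' ψ'' F' = F' → F' = B F' → F' = Fstar) := by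
  classical
  have hTint : ∀ ψ, Bel ψ → ∀ a s s', Integrable (fun θ => Tθ θ a s s') (ψ a s) := by
    intro ψ hψ a s s'
    have := ((hBel ψ).1 hψ a s).1
    refine Integrable.of_bound (hTmeas a s s').aestronglyMeasurable 1 (ae_of_all _ fun θ => ?_)
    rw [Real.norm_eq_abs, abs_of_nonneg (hT0 θ a s s'), ← hT1 θ a s]
    exact Finset.single_le_sum (fun i _ => hT0 θ a s i) (Finset.mem_univ s')
  have hp0 : ∀ (ψ : A → S → Measure Θ) a s s', 0 ≤ ∫ θ, Tθ θ a s s' ∂(ψ a s) := fun ψ a s s' =>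
    integral_nonneg fun θ => hT0 θ a s s'
  have hp1 : ∀ ψ, Bel ψ → ∀ a s, ∑ s', ∫ θ, Tθ θ a s s' ∂(ψ a s) = 1 := by
    intro ψ hψ a s
    have := ((hBel ψ).1 hψ a s).1
    rw [← integral_finsetSum _ fun s' _ => hTint ψ hψ a s s']
    simp [hT1]
  have hval : ∀ π ψ, Bel ψ → ∀ F s, Top π ψ F s = ∑ a, π s a *
      (-(1/α) * Real.log (π s a / ρ s a) +
        (-(1/β) * ∫ θ, Real.log (((ψ a s).rnDeriv (μ a s) θ).toReal) ∂(ψ a s) +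
          ∑ s', (∫ θ, Tθ θ a s s' ∂(ψ a s)) * (R s a s' + γ * F s'))) := by
    intro π ψ hψ F s
    rw [hTop]
    refine Finset.sum_congr rfl fun a _ => ?_
    obtain ⟨_, _, hint⟩ := (hBel ψ).1 hψ a s
    rw [integral_belief_eq (ψ a s) hint (hTint ψ hψ a s)]
  have hdisc : ∀ π ψ, Pol π → Bel ψ → IsDiscounted γ (Top π ψ) := by
    intro π ψ hπ hψ F G d h s
    obtain ⟨hπ0, hπ1⟩ := (hPol π).1 hπ
    rw [hval π ψ hψ, hval π ψ hψ, ← one_mul (γ * d), ← hπ1 s, Finset.sum_mul,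
      ← Finset.sum_add_distrib]
    refine Finset.sum_le_sum fun a _ => ?_
    rw [← mul_add]
    refine mul_le_mul_of_nonneg_left ?_ (hπ0 s a)
    have hsum : ∑ s', (∫ θ, Tθ θ a s s' ∂(ψ a s)) * (R s a s' + γ * F s') ≤
        ∑ s', (∫ θ, Tθ θ a s s' ∂(ψ a s)) * (R s a s' + γ * G s') + γ * d := by
      rw [← one_mul (γ * d), ← hp1 ψ hψ a s, Finset.sum_mul, ← Finset.sum_add_distrib]
      refine Finset.sum_le_sum fun s' _ => ?_
      rw [← mul_add]
      refine mul_le_mul_of_nonneg_left ?_ (hp0 ψ a s s')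
      nlinarith [h s']
    linarith
  have hrew : ∀ ψ, Bel ψ → ∀ a s,
      |∑ s', (∫ θ, Tθ θ a s s' ∂(ψ a s)) * (R s a s' + γ * (0 : S → ℝ) s')| ≤ CR := by
    intro ψ hψ a s
    exact abs_sum_mul_le_of_sum_eq_one_s18 (hp0 ψ a s) (hp1 ψ hψ a s) (by simpa using hR s a)
  have hβ' : 0 ≤ -(1/β) := by
    rw [neg_nonneg]; exact (one_div_neg.2 hβ).le
  have hlow : ∀ π, Pol π → ∃ M, ∀ ψ, Bel ψ → ∀ s, -M ≤ Top π ψ 0 s := by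
    intro π hπ
    obtain ⟨hπ0, hπ1⟩ := (hPol π).1 hπ
    obtain ⟨m, hm⟩ := Finite.exists_min fun s =>
      ∑ a, π s a * (-(1/α) * Real.log (π s a / ρ s a) - CR)
    refine ⟨-∑ a, π m a * (-(1/α) * Real.log (π m a / ρ m a) - CR), fun ψ hψ s => ?_⟩
    rw [neg_neg, hval π ψ hψ]
    refine (hm s).trans (Finset.sum_le_sum fun a _ => mul_le_mul_of_nonneg_left ?_ (hπ0 s a))
    obtain ⟨_, hac, _⟩ := (hBel ψ).1 hψ a s
    have := hμ a s
    have hkl := mul_nonneg hβ' (integral_log_rnDeriv_nonneg (ψ a s) (μ a s) hac)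
    linarith [(abs_le.1 (hrew ψ hψ a s)).1]
  have hupp : ∀ ψ, Bel ψ → ∃ M, ∀ π, Pol π → ∀ s, Top π ψ 0 s ≤ M := by
    intro ψ hψ
    obtain ⟨m, hm⟩ := Finite.exists_max fun as : A × S =>
      -(1/β) * ∫ θ, Real.log (((ψ as.1 as.2).rnDeriv (μ as.1 as.2) θ).toReal) ∂(ψ as.1 as.2)
    set K := -(1/β) * ∫ θ, Real.log (((ψ m.1 m.2).rnDeriv (μ m.1 m.2) θ).toReal) ∂(ψ m.1 m.2)
    refine ⟨1 / α + (K + CR), fun π hπ s => ?_⟩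
    obtain ⟨hπ0, hπ1⟩ := (hPol π).1 hπ
    calc Top π ψ 0 s ≤ ∑ a, (1 / α * ρ s a + π s a * (K + CR)) := by
          rw [hval π ψ hψ]
          refine Finset.sum_le_sum fun a _ => ?_
          have h1 := mul_le_mul_of_nonneg_left (mul_neg_log_div_le (hπ0 s a) (hρpos s a))
            (one_div_pos.2 hα).le
          have h2 := mul_le_mul_of_nonneg_left
            (add_le_add (hm (a, s)) (abs_le.1 (hrew ψ hψ a s)).2) (hπ0 s a)
          simp only at h2
          linarith
      _ = 1 / α + (K + CR) := by
          rw [Finset.sum_add_distrib, ← Finset.mul_sum, ← Finset.sum_mul, hρsum, hπ1]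
          ring
  have hmixQ : ∀ ψ ψ', Bel ψ → Bel ψ' → ∀ s, ∃ φ, Bel φ ∧ ∀ π F,
      Top π φ F s = Top π ψ F s ∧ ∀ s', s' ≠ s → Top π φ F s' = Top π ψ' F s' := by
    intro ψ ψ' hψ hψ' s
    refine ⟨fun a t => if t = s then ψ a t else ψ' a t, (hBel _).2 fun a t => ?_,
      fun π F => ⟨by simp [hTop], fun t hts => by simp [hTop, hts]⟩⟩
    by_cases hts : t = s
    · simpa only [if_pos hts] using (hBel ψ).1 hψ a t
    · simpa only [if_neg hts] using (hBel ψ').1 hψ' a t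
  have hmixP : ∀ π π', Pol π → Pol π' → ∀ s, ∃ σ, Pol σ ∧ ∀ ψ F,
      Top σ ψ F s = Top π ψ F s ∧ ∀ s', s' ≠ s → Top σ ψ F s' = Top π' ψ F s' := by
    intro π π' hπ hπ' s
    refine ⟨fun t => if t = s then π t else π' t, (hPol _).2 ⟨fun t => ?_, fun t => ?_⟩,
      fun ψ F => ⟨by simp [hTop], fun t hts => by simp [hTop, hts]⟩⟩
    all_goals by_cases hts : t = s
    · simpa only [if_pos hts] using ((hPol π).1 hπ).1 t
    · simpa only [if_neg hts] using ((hPol π').1 hπ').1 t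
    · simpa only [if_pos hts] using ((hPol π).1 hπ).2 t
    · simpa only [if_neg hts] using ((hPol π').1 hπ').2 t
  have hbellman : Fstar = B Fstar := funext fun s => by
    rw [hB]
    exact eq_sSup_sInf_apply hγ0.le hγ1 hdisc hlow hupp hmixQ hmixP hπstar hψstar hfixstar
      hsupinf hinner s
  refine ⟨hbellman, fun _ _ F' _ _ _ hF' => funext fun s => ?_⟩
  have hBdisc : IsDiscounted γ B := by
    have := IsDiscounted.sSup_sInf hdisc hlow hupp ⟨_, hπstar⟩ ⟨_, hψstar⟩
    rwa [← show B = _ from funext fun F => funext fun s => hB F s] at this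
  exact le_antisymm
    (hBdisc.le_of_le_apply hγ1 (fun t => (congrFun hF' t).le) (fun t => (congrFun hbellman t).ge) s)
    (hBdisc.le_of_le_apply hγ1 (fun t => (congrFun hbellman t).le) (fun t => (congrFun hF' t).ge) s)
end
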